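/- Let ε > 0, let ψ : ℝ → ℂ be a Schwartz function with derivative ψ', let (c_n)_{n≥1} ⊂ ℂ satisfy Σ_{n=1}^∞ n |c_n| < ∞, set s(x) = Σ_{n=1}^∞ c_n e^{i n x}, and let φ : ℝ → ℝ be C² with φ'(t) > 0 and |φ''(t)| ≤ ε φ'(t) for all t and M'' := sup |φ''| < ∞. Then for every A₀ ≥ 0, a > 0 and b ∈ ℝ: | ∫_ℝ A₀ [ s(2π φ(t)) − s(2π (φ(b) + φ'(b)(t−b))) ] a^{−3/2} conj(ψ'((t−b)/a)) dt | ≤ 2π ε A₀ (Σ_{n=1}^∞ n |c_n|) ( (1/2) a^{3/2} I'₂ φ'(b) + (1/6) M'' a^{5/2} I'₃ ). -/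

import Mathlib

open Real MeasureTheory

/-- If `|g''| ≤ ε (K + M x)` on `[0, ∞)`, then the first-order Taylor remainder of `g` at `0` is at
most `ε (K x² / 2 + M x³ / 6)`. -/
theorem abs_taylor_remainder_le_of_affine_bound {g g' g'' : ℝ → ℝ} {ε K M : ℝ}
    (hg : ∀ x, HasDerivAt g (g' x) x) (hg' : ∀ x, HasDerivAt g' (g'' x) x)
    (bound : ∀ x, 0 ≤ x → |g'' x| ≤ ε * (K + M * x)) {x : ℝ} (hx : 0 ≤ x) :
    |g x - g 0 - g' 0 * x| ≤ ε * (K * x ^ 2 / 2 + M * x ^ 3 / 6) := by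
  have hfirst : ∀ y, 0 ≤ y → |g' y - g' 0| ≤ ε * (K * y + M * y ^ 2 / 2) := by
    intro y hy
    have hd : ∀ u, HasDerivAt (fun u => g' u - g' 0) (g'' u) u := fun u => (hg' u).sub_const _
    refine image_norm_le_of_norm_deriv_right_le_deriv_boundary (a := 0) (b := y)
      (f := fun u => g' u - g' 0) (B := fun u => ε * (K * u + M * u ^ 2 / 2))
      (B' := fun u => ε * (K + M * u))
      (fun u _ => (hd u).continuousAt.continuousWithinAt) (fun u _ => (hd u).hasDerivWithinAt)
      (by simp) (fun u => ?_) (fun u hu => bound u hu.1) ⟨hy, le_rfl⟩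
    convert! (((hasDerivAt_id u).const_mul K).add
      ((((hasDerivAt_id u).pow 2).const_mul M).div_const 2)).const_mul ε using 1
    simp only [id_eq]
    push_cast
    ring
  have hd : ∀ u, HasDerivAt (fun u => g u - g 0 - g' 0 * u) (g' u - g' 0) u := by
    intro u
    convert! ((hg u).sub_const (g 0)).sub ((hasDerivAt_id u).const_mul (g' 0)) using 1
    rw [mul_one]
  refine image_norm_le_of_norm_deriv_right_le_deriv_boundary (a := 0) (b := x)
    (f := fun u => g u - g 0 - g' 0 * u) (B := fun u => ε * (K * u ^ 2 / 2 + M * u ^ 3 / 6))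
    (B' := fun u => ε * (K * u + M * u ^ 2 / 2))
    (fun u _ => (hd u).continuousAt.continuousWithinAt) (fun u _ => (hd u).hasDerivWithinAt)
    (by simp) (fun u => ?_) (fun u hu => hfirst u hu.1) ⟨hx, le_rfl⟩
  convert! (((((hasDerivAt_id u).pow 2).const_mul K).div_const 2).add
    ((((hasDerivAt_id u).pow 3).const_mul M).div_const 6)).const_mul ε using 1
  simp only [id_eq]
  push_cast
  ring

/-- A `C²` function with `|φ''| ≤ ε φ'` and `|φ''| ≤ M` stays close to its tangent lines. -/
theorem abs_sub_tangent_le {φ : ℝ → ℝ} {ε M : ℝ} (hε : 0 ≤ ε) (hφ : ContDiff ℝ 2 φ)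
    (hφ'' : ∀ t, |deriv (deriv φ) t| ≤ ε * deriv φ t) (hM : ∀ t, |deriv (deriv φ) t| ≤ M)
    (b t : ℝ) :
    |φ t - (φ b + deriv φ b * (t - b))| ≤
      ε * (deriv φ b * |t - b| ^ 2 / 2 + M * |t - b| ^ 3 / 6) := by
  have hd : ∀ u, HasDerivAt φ (deriv φ u) u := fun u =>
    (hφ.differentiable (by norm_num) u).hasDerivAt
  have hC1 : ContDiff ℝ 1 (deriv φ) := ((contDiff_succ_iff_deriv (n := 1)).1 hφ).2.2
  have hd' : ∀ u, HasDerivAt (deriv φ) (deriv (deriv φ) u) u := fun u =>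
    (hC1.differentiable (by norm_num) u).hasDerivAt
  have hgrowth : ∀ u, |deriv (deriv φ) u| ≤ ε * (deriv φ b + M * |u - b|) := by
    intro u
    have h := convex_univ.norm_image_sub_le_of_norm_deriv_le (f := deriv φ)
      (fun v _ => (hd' v).differentiableAt) (fun v _ => hM v) (Set.mem_univ b) (Set.mem_univ u)
    refine (hφ'' u).trans (mul_le_mul_of_nonneg_left ?_ hε)
    have := (le_abs_self _).trans h
    rw [Real.norm_eq_abs] at this
    linarith
  rcases le_total b t with h | h
  · have key := abs_taylor_remainder_le_of_affine_bound (g := fun x => φ (b + x))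
      (fun x => (hd (b + x)).comp_const_add b x) (fun x => (hd' (b + x)).comp_const_add b x)
      (fun x hx => by simpa [abs_of_nonneg hx] using hgrowth (b + x)) (sub_nonneg.2 h)
    rw [abs_of_nonneg (sub_nonneg.2 h)]
    convert key using 2
    simp
    ring
  · have hd'' : ∀ x, HasDerivAt (fun x => -deriv φ (b - x)) (deriv (deriv φ) (b - x)) x :=
      fun x => by
        convert! ((hd' (b - x)).comp_const_sub b x).neg using 1
        rw [neg_neg]
    have key := abs_taylor_remainder_le_of_affine_bound (g := fun x => φ (b - x))
      (fun x => (hd (b - x)).comp_const_sub b x) hd''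
      (fun x hx => by simpa [abs_of_nonneg hx] using hgrowth (b - x)) (sub_nonneg.2 h)
    rw [abs_sub_comm t b, abs_of_nonneg (sub_nonneg.2 h)]
    convert key using 2
    simp
    ring

/-- `x ↦ exp (i n x)` is Lipschitz with constant `n`. -/
theorem norm_exp_I_mul_sub_le (n : ℕ) (x y : ℝ) :
    ‖Complex.exp (Complex.I * ((n : ℂ) + 1) * x) - Complex.exp (Complex.I * ((n : ℂ) + 1) * y)‖ ≤
      ((n : ℝ) + 1) * |x - y| := by
  have h : Complex.exp (Complex.I * ((n : ℂ) + 1) * x) -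
      Complex.exp (Complex.I * ((n : ℂ) + 1) * y) =
      Complex.exp (Complex.I * (((n + 1) * y : ℝ) : ℂ)) *
        (Complex.exp (Complex.I * (((n + 1) * (x - y) : ℝ) : ℂ)) - 1) := by
    rw [mul_sub, ← Complex.exp_add, mul_one]
    congr 2 <;> push_cast <;> ring
  rw [h, norm_mul, mul_comm Complex.I ((_ : ℝ) : ℂ), Complex.norm_exp_ofReal_mul_I, one_mul]
  refine Real.norm_exp_I_mul_ofReal_sub_one_le.trans_eq ?_
  rw [Real.norm_eq_abs, abs_mul, abs_of_nonneg (by positivity)]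

/-- A trigonometric series `∑ cₙ exp (i n x)` with `∑ n |cₙ| < ∞` is Lipschitz with constant
`∑ n |cₙ|`. -/
theorem norm_trigSeries_sub_le {c : ℕ → ℂ}
    (hc : Summable fun n : ℕ => ((n : ℝ) + 1) * ‖c (n + 1)‖) (x y : ℝ) :
    ‖(∑' n : ℕ, c (n + 1) * Complex.exp (Complex.I * ((n : ℂ) + 1) * (x : ℂ))) -
        ∑' n : ℕ, c (n + 1) * Complex.exp (Complex.I * ((n : ℂ) + 1) * (y : ℂ))‖ ≤
      (∑' n : ℕ, ((n : ℝ) + 1) * ‖c (n + 1)‖) * |x - y| := by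
  have hsum : ∀ z : ℝ, Summable fun n : ℕ =>
      c (n + 1) * Complex.exp (Complex.I * ((n : ℂ) + 1) * (z : ℂ)) := by
    intro z
    refine Summable.of_norm_bounded hc fun n => ?_
    have h : Complex.I * ((n : ℂ) + 1) * (z : ℂ) = (((n + 1) * z : ℝ) : ℂ) * Complex.I := by
      push_cast
      ring
    rw [norm_mul, h, Complex.norm_exp_ofReal_mul_I, mul_one]
    exact le_mul_of_one_le_left (norm_nonneg _) (by linarith [n.cast_nonneg (α := ℝ)])
  rw [← (hsum x).tsum_sub (hsum y), ← tsum_mul_right]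
  refine tsum_of_norm_bounded (hc.mul_right _).hasSum fun n => ?_
  rw [← mul_sub, norm_mul, mul_comm ((n : ℝ) + 1), mul_assoc ‖c (n + 1)‖]
  exact mul_le_mul_of_nonneg_left (norm_exp_I_mul_sub_le n x y) (norm_nonneg (c (n + 1)))

/-- With `s(x) = Σ_{n≥1} c_n e^{inx}`, `Σ n |c_n| < ∞`, `ψ` Schwartz with
derivative `ψ'`, `φ` C² with `φ' > 0`, `|φ''| ≤ ε φ'`, `M'' := sup|φ''| < ∞`, for every
`A₀ ≥ 0`, `a > 0`, `b`:
`|∫ A₀ [s(2πφ(t)) − s(2π(φ(b) + φ'(b)(t−b)))] a^{−3/2} conj(ψ'((t−b)/a)) dt|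
  ≤ 2πεA₀ (Σ n|c_n|) ((1/2) a^{3/2} I'₂ φ'(b) + (1/6) M'' a^{5/2} I'₃)`. -/
theorem statement10 (ε : ℝ) (hε : 0 < ε) (ψ : SchwartzMap ℝ ℂ) (c : ℕ → ℂ)
    (hc : Summable fun n : ℕ => ((n : ℝ) + 1) * ‖c (n + 1)‖)
    (s : ℝ → ℂ)
    (hs : ∀ x : ℝ, s x = ∑' n : ℕ, c (n + 1) * Complex.exp (Complex.I * ((n : ℂ) + 1) * (x : ℂ)))
    (φ : ℝ → ℝ) (hφ : ContDiff ℝ 2 φ) (hφ' : ∀ t, 0 < deriv φ t)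
    (hφ'' : ∀ t, |deriv (deriv φ) t| ≤ ε * deriv φ t)
    (hM : BddAbove (Set.range fun t => |deriv (deriv φ) t|)) :
    ∀ A₀ : ℝ, 0 ≤ A₀ → ∀ a b : ℝ, 0 < a →
      ‖∫ t : ℝ, (A₀ : ℂ) * (s (2 * π * φ t) - s (2 * π * (φ b + deriv φ b * (t - b)))) *
          ((a ^ ((3 : ℝ) / 2) : ℝ) : ℂ)⁻¹ * starRingEnd ℂ (deriv (⇑ψ) ((t - b) / a))‖ ≤
        2 * π * ε * A₀ * (∑' n : ℕ, ((n : ℝ) + 1) * ‖c (n + 1)‖) *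
          ((1 / 2) * a ^ ((3 : ℝ) / 2) * (∫ x : ℝ, |x| ^ 2 * ‖deriv (⇑ψ) x‖) * deriv φ b +
            (1 / 6) * (⨆ t, |deriv (deriv φ) t|) * a ^ ((5 : ℝ) / 2) *
              (∫ x : ℝ, |x| ^ 3 * ‖deriv (⇑ψ) x‖)) := by
  intro A₀ hA₀ a b ha
  set S := ∑' n : ℕ, ((n : ℝ) + 1) * ‖c (n + 1)‖
  set M := ⨆ t, |deriv (deriv φ) t|
  set r := a ^ ((3 : ℝ) / 2) with hr
  have hr_pos : 0 < r := Real.rpow_pos_of_pos ha _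
  have hS : 0 ≤ S := tsum_nonneg fun n => by positivity
  have hr_sq : r * r = a ^ 3 := by
    rw [hr, ← Real.rpow_add ha, ← Real.rpow_natCast]
    norm_num
  have hr_mul : a ^ ((5 : ℝ) / 2) = a * r := by
    rw [hr, show (5 : ℝ) / 2 = 1 + 3 / 2 by norm_num, Real.rpow_add ha, Real.rpow_one]
  have hint : ∀ k : ℕ, Integrable fun x : ℝ => |x| ^ k * ‖deriv (⇑ψ) x‖ := fun k => by
    simpa using (SchwartzMap.derivCLM ℝ ℂ ψ).integrable_pow_mul volume k
  set C₂ := 2 * π * ε * A₀ * S * r⁻¹ * (deriv φ b * a ^ 2 / 2)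
  set C₃ := 2 * π * ε * A₀ * S * r⁻¹ * (M * a ^ 3 / 6)
  set G : ℝ → ℝ := fun x =>
    C₂ * (|x| ^ 2 * ‖deriv (⇑ψ) x‖) + C₃ * (|x| ^ 3 * ‖deriv (⇑ψ) x‖) with hG
  have hG_int : Integrable G := ((hint 2).const_mul C₂).add ((hint 3).const_mul C₃)
  have hG_comp : Integrable fun t => G ((t - b) / a) :=
    (hG_int.comp_div ha.ne').comp_sub_right b
  have hpoint : ∀ t : ℝ,
      ‖(A₀ : ℂ) * (s (2 * π * φ t) - s (2 * π * (φ b + deriv φ b * (t - b)))) *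
          ((r : ℝ) : ℂ)⁻¹ * starRingEnd ℂ (deriv (⇑ψ) ((t - b) / a))‖ ≤ G ((t - b) / a) := by
    intro t
    have hlip : ‖s (2 * π * φ t) - s (2 * π * (φ b + deriv φ b * (t - b)))‖ ≤
        S * (2 * π * (ε * (deriv φ b * |t - b| ^ 2 / 2 + M * |t - b| ^ 3 / 6))) := by
      rw [hs, hs]
      refine (norm_trigSeries_sub_le hc _ _).trans ?_
      rw [← mul_sub, abs_mul, abs_of_pos Real.two_pi_pos]
      gcongr
      exact abs_sub_tangent_le hε.le hφ hφ'' (fun u => le_ciSup hM u) b t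
    have habs : |t - b| = a * |(t - b) / a| := by
      rw [abs_div, abs_of_pos ha]
      field_simp
    rw [norm_mul, norm_mul, norm_mul, RCLike.norm_conj, norm_inv, Complex.norm_real,
      Complex.norm_real, Real.norm_of_nonneg hA₀, Real.norm_of_nonneg hr_pos.le]
    calc _ ≤ A₀ * (S * (2 * π * (ε * (deriv φ b * |t - b| ^ 2 / 2 + M * |t - b| ^ 3 / 6)))) *
          r⁻¹ * ‖deriv (⇑ψ) ((t - b) / a)‖ := by gcongr
      _ = G ((t - b) / a) := by
        rw [habs]
        simp only [hG, C₂, C₃]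
        ring
  refine (norm_integral_le_of_norm_le hG_comp (ae_of_all _ hpoint)).trans_eq ?_
  rw [integral_sub_right_eq_self (fun t => G (t / a)) b, Measure.integral_comp_div G a,
    integral_add ((hint 2).const_mul C₂) ((hint 3).const_mul C₃), integral_const_mul,
    integral_const_mul, abs_of_pos ha, smul_eq_mul, hr_mul]
  have hr_inv : r⁻¹ = r / a ^ 3 := by
    rw [← hr_sq]
    field_simp
  simp only [C₂, C₃, hr_inv]
  field_simp
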